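/- arXiv:1011.4367 — 2 statements merged into one kernel-verified Lean document; each statement's English description precedes it below -/
import Mathlib

section
/- There exist constants C₀ > 0 and C₁ > 0, independent of ε, r and k, such that for every ε > 0, every r ∈ (0, 1/2), every k ∈ ℤ², every m ∈ {1,2,3} and every x ∈ ℝ³ with r ≤ R^k(x) ≤ 1 and 0 < x₃ < L: |e_m − w_ε^{mk}(x)| ≤ C₀, where e_m is the m-th vector of the canonical basis of ℝ³, and for i = 1,2,3, |∂w_ε^{mk}/∂x_i (x)|² ≤ C₁ / ((R^k(x))² ln²(r)). -/
open Real MeasureTheory Filter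

/-- `Ω = ω × (0,L)` as a subset of `ℝ³ = ℝ × ℝ × ℝ`. -/
def OmegaSet (ω : Set (ℝ × ℝ)) (L : ℝ) : Set (ℝ × ℝ × ℝ) :=
  {x | (x.1, x.2.1) ∈ ω ∧ x.2.2 ∈ Set.Ioo 0 L}

/-- `K(ε)`: indices `k ∈ ℤ²` whose `ε`-cell `(εk₁,εk₂) + [−ε/2,ε/2]²` is contained in `ω`. -/
def Kset (ω : Set (ℝ × ℝ)) (ε : ℝ) : Set (ℤ × ℤ) :=
  {k | Set.Icc (ε * k.1 - ε / 2) (ε * k.1 + ε / 2) ×ˢ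
        Set.Icc (ε * k.2 - ε / 2) (ε * k.2 + ε / 2) ⊆ ω}

/-- Distance `R^k(x) = ((x₁−εk₁)² + (x₂−εk₂)²)^{1/2}` from `x` to the axis of the `k`-th fiber. -/
noncomputable def Rk (ε : ℝ) (k : ℤ × ℤ) (x : ℝ × ℝ × ℝ) : ℝ :=
  Real.sqrt ((x.1 - ε * k.1) ^ 2 + (x.2.1 - ε * k.2) ^ 2)

/-- Partial derivative in the `i`-th direction of a function of three real variables. -/
noncomputable def pd3 (i : Fin 3) (f : ℝ → ℝ → ℝ → ℝ) (a b c : ℝ) : ℝ :=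
  if i = 0 then deriv (fun t => f t b c) a
  else if i = 1 then deriv (fun t => f a t c) b
  else deriv (fun t => f a b t) c

/-- Symmetrized gradient `e_ij(u) = (1/2)(∂u_i/∂x_j + ∂u_j/∂x_i)` of a field on `ℝ³`. -/
noncomputable def strain3 (u : Fin 3 → ℝ → ℝ → ℝ → ℝ) (i j : Fin 3) (a b c : ℝ) : ℝ :=
  (pd3 j (u i) a b c + pd3 i (u j) a b c) / 2

/-- Three-dimensional stress tensor `σ_ij(u) = λ e_mm(u) δ_ij + 2μ e_ij(u)`. -/
noncomputable def stress3 (lam mu : ℝ) (u : Fin 3 → ℝ → ℝ → ℝ → ℝ) (i j : Fin 3)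
    (a b c : ℝ) : ℝ :=
  lam * (strain3 u 0 0 a b c + strain3 u 1 1 a b c + strain3 u 2 2 a b c) *
      (if i = j then 1 else 0) +
    2 * mu * strain3 u i j a b c

/-- First component of the plane elastic field `w¹`. -/
noncomputable def w11 (κ y₁ y₂ : ℝ) : ℝ :=
  -Real.log (Real.sqrt (y₁ ^ 2 + y₂ ^ 2)) +
    (y₂ ^ 2 - y₁ ^ 2) / (2 * κ * (y₁ ^ 2 + y₂ ^ 2)) -
    (y₂ ^ 2 - y₁ ^ 2) / (2 * κ * (y₁ ^ 2 + y₂ ^ 2) ^ 2)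

/-- Second component of `w¹`, which also equals the first component of `w²`. -/
noncomputable def w12 (κ y₁ y₂ : ℝ) : ℝ :=
  y₁ * y₂ / (κ * (y₁ ^ 2 + y₂ ^ 2)) - y₁ * y₂ / (κ * (y₁ ^ 2 + y₂ ^ 2) ^ 2)

/-- Second component of the plane elastic field `w²`. -/
noncomputable def w22 (κ y₁ y₂ : ℝ) : ℝ :=
  -Real.log (Real.sqrt (y₁ ^ 2 + y₂ ^ 2)) -
    (y₂ ^ 2 - y₁ ^ 2) / (2 * κ * (y₁ ^ 2 + y₂ ^ 2)) +
    (y₂ ^ 2 - y₁ ^ 2) / (2 * κ * (y₁ ^ 2 + y₂ ^ 2) ^ 2)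

/-- The plane elastic fields `w^m`, `m = 1,2` (indexed by `Fin 2`). -/
noncomputable def wplane (κ : ℝ) (m i : Fin 2) (y₁ y₂ : ℝ) : ℝ :=
  if m = 0 then (if i = 0 then w11 κ y₁ y₂ else w12 κ y₁ y₂)
  else (if i = 0 then w12 κ y₁ y₂ else w22 κ y₁ y₂)

/-- The rescaled local test fields `w_ε^{mk}` on `ℝ³`: `wEps κ ε r k m i x₁ x₂ x₃` is the
`i`-th component of `w_ε^{(m+1)k}(x)`, built from the plane solutions `w¹, w²` and
`w(y) = −ln|y|` via `y = ((x₁−εk₁)/r, (x₂−εk₂)/r)` and the factor `−1/ln r`. -/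
noncomputable def wEps (κ ε r : ℝ) (k : ℤ × ℤ) (m i : Fin 3) (x₁ x₂ x₃ : ℝ) : ℝ :=
  (-1 / Real.log r) *
    (if m = 2 then
      (if i = 2 then -Real.log (Real.sqrt (((x₁ - ε * k.1) / r) ^ 2 + ((x₂ - ε * k.2) / r) ^ 2))
       else 0)
     else if i = 2 then 0
     else
       wplane κ (if m = 0 then 0 else 1) (if i = 0 then 0 else 1)
         ((x₁ - ε * k.1) / r) ((x₂ - ε * k.2) / r))

def GoodF (f : ℝ → ℝ → ℝ) : Prop :=
  ∀ p q ρ : ℝ, 1 ≤ ρ → ρ ^ 2 = p ^ 2 + q ^ 2 →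
    |f p q| ≤ 2 + Real.log ρ ∧
    (∃ d, HasDerivAt (fun t => f t q) d p ∧ |d| ≤ 11 / ρ) ∧
    (∃ d, HasDerivAt (fun t => f p t) d q ∧ |d| ≤ 11 / ρ)

lemma aux_log (p q ρ : ℝ) (hρ : 1 ≤ ρ) (h : ρ ^ 2 = p ^ 2 + q ^ 2) :
    ∃ d, HasDerivAt (fun t => -Real.log (Real.sqrt (t ^ 2 + q ^ 2))) d p ∧ |d| ≤ 1 / ρ := by
  have h0 : 0 < ρ := by linarith
  have hs : p ^ 2 + q ^ 2 ≠ 0 := by rw [← h]; positivity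
  refine ⟨-(p / ρ ^ 2), ?_, ?_⟩
  · have h1 : HasDerivAt (fun t : ℝ => t ^ 2 + q ^ 2) (2 * p) p := by
      simpa using (hasDerivAt_pow 2 p).add_const (q ^ 2)
    have h2 := ((h1.log hs).div_const 2).neg
    have e : (fun t => -Real.log (Real.sqrt (t ^ 2 + q ^ 2)))
        = fun t : ℝ => -(Real.log (t ^ 2 + q ^ 2) / 2) := by
      funext t
      rw [Real.log_sqrt (by positivity)]
    rw [e]
    refine HasDerivAt.congr_deriv (f' := -(2 * p / (p ^ 2 + q ^ 2) / 2)) h2 ?_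
    rw [← h]; field_simp
  · have hp : |p| ≤ ρ := abs_le_of_sq_le_sq (by nlinarith [sq_nonneg q]) h0.le
    rw [abs_neg, abs_div, abs_of_pos (by positivity : 0 < ρ ^ 2), div_le_div_iff₀ (by positivity) h0]
    nlinarith

lemma aux_val (c N ρ : ℝ) (hc : 1 ≤ c) (hρ : 1 ≤ ρ) (hN : |N| ≤ ρ ^ 2) :
    |N / (c * ρ ^ 2) - N / (c * (ρ ^ 2) ^ 2)| ≤ 2 := by
  have h0 : 0 < ρ := by linarith
  have h1 : (1:ℝ) ≤ ρ ^ 2 := by nlinarith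
  have a1 : |N / (c * ρ ^ 2)| ≤ 1 := by
    rw [abs_div, abs_of_pos (by positivity : 0 < c * ρ ^ 2), div_le_one (by positivity)]
    nlinarith
  have a2 : |N / (c * (ρ ^ 2) ^ 2)| ≤ 1 := by
    rw [abs_div, abs_of_pos (by positivity : 0 < c * (ρ ^ 2) ^ 2), div_le_one (by positivity)]
    have : ρ ^ 2 ≤ (ρ ^ 2) ^ 2 := by nlinarith
    nlinarith
  have := abs_sub (N / (c * ρ ^ 2)) (N / (c * (ρ ^ 2) ^ 2))
  linarith

lemma aux_der (c : ℝ) (hc : 1 ≤ c) (N : ℝ → ℝ) (N' p q ρ : ℝ) (hρ : 1 ≤ ρ)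
    (h : ρ ^ 2 = p ^ 2 + q ^ 2) (hd : HasDerivAt N N' p) (hN : |N p| ≤ ρ ^ 2)
    (hN' : |N'| ≤ 2 * ρ) :
    ∃ d, HasDerivAt (fun t => N t / (c * (t ^ 2 + q ^ 2)) - N t / (c * (t ^ 2 + q ^ 2) ^ 2)) d p
      ∧ |d| ≤ 10 / ρ := by
  have h0 : 0 < ρ := by linarith
  have c0 : 0 < c := by linarith
  have hs : p ^ 2 + q ^ 2 ≠ 0 := by rw [← h]; positivity
  have hp : |p| ≤ ρ := abs_le_of_sq_le_sq (by nlinarith [sq_nonneg q]) h0.le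
  refine ⟨(N' / ρ ^ 2 - N' / ρ ^ 4 - 2 * (N p * p) / ρ ^ 4 + 4 * (N p * p) / ρ ^ 6) / c, ?_, ?_⟩
  · have h1 : HasDerivAt (fun t : ℝ => t ^ 2 + q ^ 2) (2 * p) p := by
      simpa using (hasDerivAt_pow 2 p).add_const (q ^ 2)
    have h2 := h1.const_mul c
    have h3 := (h1.pow 2).const_mul c
    have h4 := (hd.div h2 (by positivity)).sub (hd.div h3 (by
      simp only [Pi.pow_apply]; positivity))
    refine HasDerivAt.congr_deriv h4 ?_
    simp only [Pi.pow_apply]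
    rw [← h]; field_simp; ring
  · have hNp : |N p * p| ≤ ρ ^ 3 := by
      rw [abs_mul]
      calc |N p| * |p| ≤ ρ ^ 2 * ρ := by gcongr
        _ = ρ ^ 3 := by ring
    have e46 : ∀ n : ℕ, ρ ^ 3 / ρ ^ (4 + n) ≤ 1 / ρ := by
      intro n
      rw [div_le_div_iff₀ (by positivity) h0]
      have := one_le_pow₀ hρ (n := n)
      have h4 : 0 < ρ ^ 4 := by positivity
      rw [pow_add]; nlinarith
    have b1 : |N' / ρ ^ 2| ≤ 2 / ρ := by
      rw [abs_div, abs_of_pos (by positivity : 0 < ρ ^ 2), div_le_div_iff₀ (by positivity) h0]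
      nlinarith
    have b2 : |N' / ρ ^ 4| ≤ 2 / ρ := by
      refine le_trans ?_ b1
      rw [abs_div, abs_div, abs_of_pos (by positivity : 0 < ρ ^ 2),
        abs_of_pos (by positivity : 0 < ρ ^ 4)]
      gcongr
      norm_num
    have b3 : |2 * (N p * p) / ρ ^ 4| ≤ 2 * (1 / ρ) := by
      rw [mul_div_assoc, abs_mul, abs_two, abs_div, abs_of_pos (by positivity : 0 < ρ ^ 4)]
      have := e46 0
      have h5 : |N p * p| / ρ ^ 4 ≤ ρ ^ 3 / ρ ^ 4 := by gcongr
      simp only [add_zero] at this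
      linarith
    have b4 : |4 * (N p * p) / ρ ^ 6| ≤ 4 * (1 / ρ) := by
      rw [mul_div_assoc, abs_mul, abs_of_pos (by norm_num : (0:ℝ) < 4), abs_div,
        abs_of_pos (by positivity : 0 < ρ ^ 6)]
      have := e46 2
      have h5 : |N p * p| / ρ ^ 6 ≤ ρ ^ 3 / ρ ^ 6 := by gcongr
      norm_num at this h5 ⊢
      linarith
    rw [abs_div, abs_of_pos c0]
    refine le_trans (div_le_self (abs_nonneg _) hc) ?_
    have e1 : 10 / ρ = 10 * (1 / ρ) := by ring
    have e2 : 2 / ρ = 2 * (1 / ρ) := by ring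
    rw [e2] at b1 b2
    rw [e1]
    rw [abs_le] at *
    constructor <;> linarith [b1.1, b1.2, b2.1, b2.2, b3.1, b3.2, b4.1, b4.2]

lemma good_of_swap (f g : ℝ → ℝ → ℝ) (hsw : ∀ p q, f p q = g q p)
    (hv : ∀ p q ρ : ℝ, 1 ≤ ρ → ρ ^ 2 = p ^ 2 + q ^ 2 → |f p q| ≤ 2 + Real.log ρ)
    (hf : ∀ p q ρ : ℝ, 1 ≤ ρ → ρ ^ 2 = p ^ 2 + q ^ 2 →
      ∃ d, HasDerivAt (fun t => f t q) d p ∧ |d| ≤ 11 / ρ)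
    (hg : ∀ p q ρ : ℝ, 1 ≤ ρ → ρ ^ 2 = p ^ 2 + q ^ 2 →
      ∃ d, HasDerivAt (fun t => g t q) d p ∧ |d| ≤ 11 / ρ) : GoodF f := by
  intro p q ρ hρ h
  refine ⟨hv p q ρ hρ h, hf p q ρ hρ h, ?_⟩
  obtain ⟨d, h1, h2⟩ := hg q p ρ hρ (by linarith)
  refine ⟨d, ?_, h2⟩
  simpa only [hsw] using h1

lemma good_zero : GoodF (fun _ _ => 0) := by
  intro p q ρ hρ h
  have h0 : 0 < ρ := by linarith
  have := Real.log_nonneg hρ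
  refine ⟨by simp; linarith, ⟨0, hasDerivAt_const _ _, by simp; positivity⟩,
    ⟨0, hasDerivAt_const _ _, by simp; positivity⟩⟩

lemma log_sqrt_eq (p q ρ : ℝ) (hρ : 1 ≤ ρ) (h : ρ ^ 2 = p ^ 2 + q ^ 2) :
    Real.sqrt (p ^ 2 + q ^ 2) = ρ := by
  rw [← h, Real.sqrt_sq (by linarith)]

lemma good_log : GoodF (fun p q => -Real.log (Real.sqrt (p ^ 2 + q ^ 2))) := by
  have hd : ∀ p q ρ : ℝ, 1 ≤ ρ → ρ ^ 2 = p ^ 2 + q ^ 2 →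
      ∃ d, HasDerivAt (fun t => -Real.log (Real.sqrt (t ^ 2 + q ^ 2))) d p ∧ |d| ≤ 11 / ρ := by
    intro p q ρ hρ h
    obtain ⟨d, h1, h2⟩ := aux_log p q ρ hρ h
    refine ⟨d, h1, h2.trans ?_⟩
    have h0 : 0 < ρ := by linarith
    gcongr; norm_num
  refine good_of_swap _ (fun p q => -Real.log (Real.sqrt (p ^ 2 + q ^ 2))) ?_ ?_ hd hd
  · intro p q; simp only [add_comm]
  · intro p q ρ hρ h
    simp only [log_sqrt_eq p q ρ hρ h, abs_neg]
    rw [abs_of_nonneg (Real.log_nonneg hρ)]; linarith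

/-- general form -/
lemma aux_sum (c : ℝ) (hc : 1 ≤ c) (N : ℝ → ℝ) (N' p q ρ : ℝ) (hρ : 1 ≤ ρ)
    (h : ρ ^ 2 = p ^ 2 + q ^ 2) (hd : HasDerivAt N N' p) (hN : |N p| ≤ ρ ^ 2)
    (hN' : |N'| ≤ 2 * ρ) :
    ∃ d, HasDerivAt (fun t => -Real.log (Real.sqrt (t ^ 2 + q ^ 2)) +
      (N t / (c * (t ^ 2 + q ^ 2)) - N t / (c * (t ^ 2 + q ^ 2) ^ 2))) d p
      ∧ |d| ≤ 11 / ρ := by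
  obtain ⟨d, h1, h2⟩ := aux_der c hc N N' p q ρ hρ h hd hN hN'
  obtain ⟨e, h3, h4⟩ := aux_log p q ρ hρ h
  refine ⟨e + d, h3.add h1, (abs_add_le _ _).trans ?_⟩
  have : 11 / ρ = 1 / ρ + 10 / ρ := by ring
  linarith

lemma w11_eq (κ p q : ℝ) : w11 κ p q = -Real.log (Real.sqrt (p ^ 2 + q ^ 2)) +
      ((q ^ 2 - p ^ 2) / (2 * κ * (p ^ 2 + q ^ 2))
        - (q ^ 2 - p ^ 2) / (2 * κ * (p ^ 2 + q ^ 2) ^ 2)) := by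
  unfold w11; ring

lemma w22_eq (κ p q : ℝ) : w22 κ p q = -Real.log (Real.sqrt (p ^ 2 + q ^ 2)) +
      ((p ^ 2 - q ^ 2) / (2 * κ * (p ^ 2 + q ^ 2))
        - (p ^ 2 - q ^ 2) / (2 * κ * (p ^ 2 + q ^ 2) ^ 2)) := by
  unfold w22; ring

lemma w_swap (κ p q : ℝ) : w11 κ p q = w22 κ q p := by
  rw [w11_eq, w22_eq, add_comm (p ^ 2)]

lemma absD (p q ρ : ℝ) (h : ρ ^ 2 = p ^ 2 + q ^ 2) : |q ^ 2 - p ^ 2| ≤ ρ ^ 2 := by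
  rw [abs_le]; constructor <;> nlinarith [sq_nonneg p, sq_nonneg q]

lemma w_der (κ : ℝ) (hκ : 1 ≤ κ) (p q ρ : ℝ) (hρ : 1 ≤ ρ) (h : ρ ^ 2 = p ^ 2 + q ^ 2) :
    (∃ d, HasDerivAt (fun t => w11 κ t q) d p ∧ |d| ≤ 11 / ρ) ∧
    (∃ d, HasDerivAt (fun t => w22 κ t q) d p ∧ |d| ≤ 11 / ρ) ∧
    (∃ d, HasDerivAt (fun t => w12 κ t q) d p ∧ |d| ≤ 11 / ρ) := by
  have h0 : 0 < ρ := by linarith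
  have hp : |p| ≤ ρ := abs_le_of_sq_le_sq (by nlinarith [sq_nonneg q]) h0.le
  have hq : |q| ≤ ρ := abs_le_of_sq_le_sq (by nlinarith [sq_nonneg p]) h0.le
  have hD := absD p q ρ h
  refine ⟨?_, ?_, ?_⟩
  · simp only [w11_eq]
    refine aux_sum (2 * κ) (by linarith) (fun t => q ^ 2 - t ^ 2) (-(2 * p)) p q ρ hρ h ?_ hD ?_
    · simpa using (hasDerivAt_pow 2 p).const_sub (q ^ 2)
    · rw [abs_neg, abs_mul, abs_two]; linarith
  · simp only [w22_eq]
    refine aux_sum (2 * κ) (by linarith) (fun t => t ^ 2 - q ^ 2) (2 * p) p q ρ hρ h ?_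
      (by rw [abs_sub_comm]; exact hD) ?_
    · simpa using (hasDerivAt_pow 2 p).sub_const (q ^ 2)
    · rw [abs_mul, abs_two]; linarith
  · obtain ⟨d, h1, h2⟩ := aux_der κ hκ (fun t => t * q) q p q ρ hρ h
      (by simpa using (hasDerivAt_id p).mul_const q)
      (by rw [abs_le]; constructor <;> nlinarith [sq_nonneg (p + q), sq_nonneg (p - q)])
      (by linarith)
    refine ⟨d, h1, h2.trans ?_⟩
    gcongr; norm_num

lemma good_w11 (κ : ℝ) (hκ : 1 ≤ κ) : GoodF (w11 κ) := by
  refine good_of_swap _ (w22 κ) (w_swap κ) ?_ (fun p q ρ a b => (w_der κ hκ p q ρ a b).1)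
    (fun p q ρ a b => (w_der κ hκ p q ρ a b).2.1)
  intro p q ρ hρ h
  rw [w11_eq, log_sqrt_eq p q ρ hρ h, ← h]
  have := aux_val (2 * κ) (q ^ 2 - p ^ 2) ρ (by linarith) hρ (absD p q ρ h)
  refine (abs_add_le _ _).trans ?_
  rw [abs_neg, abs_of_nonneg (Real.log_nonneg hρ)]; linarith

lemma good_w22 (κ : ℝ) (hκ : 1 ≤ κ) : GoodF (w22 κ) := by
  refine good_of_swap _ (w11 κ) (fun p q => (w_swap κ q p).symm) ?_
    (fun p q ρ a b => (w_der κ hκ p q ρ a b).2.1)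
    (fun p q ρ a b => (w_der κ hκ p q ρ a b).1)
  intro p q ρ hρ h
  rw [← w_swap]
  exact (good_w11 κ hκ q p ρ hρ (by linarith)).1

lemma good_w12 (κ : ℝ) (hκ : 1 ≤ κ) : GoodF (w12 κ) := by
  refine good_of_swap _ (w12 κ) ?_ ?_ (fun p q ρ a b => (w_der κ hκ p q ρ a b).2.2)
    (fun p q ρ a b => (w_der κ hκ p q ρ a b).2.2)
  · intro p q
    unfold w12; rw [mul_comm p q, add_comm (p ^ 2)]
  · intro p q ρ hρ h
    have := aux_val κ (p * q) ρ hκ hρ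
      (by rw [abs_le]; constructor <;> nlinarith [sq_nonneg (p + q), sq_nonneg (p - q)])
    have := Real.log_nonneg hρ
    unfold w12
    rw [← h]; linarith

lemma wEps_good (κ ε r : ℝ) (hκ : 1 ≤ κ) (k : ℤ × ℤ) (m i : Fin 3) :
    ∃ f, GoodF f ∧ wEps κ ε r k m i = fun x₁ x₂ _ =>
      (-1 / Real.log r) * f ((x₁ - ε * k.1) / r) ((x₂ - ε * k.2) / r) := by
  fin_cases m <;> fin_cases i
  · exact ⟨_, good_w11 κ hκ, by funext a b c; simp [wEps, wplane]⟩
  · exact ⟨_, good_w12 κ hκ, by funext a b c; simp [wEps, wplane]⟩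
  · exact ⟨_, good_zero, by funext a b c; simp [wEps]⟩
  · exact ⟨_, good_w12 κ hκ, by funext a b c; simp [wEps, wplane]⟩
  · exact ⟨_, good_w22 κ hκ, by funext a b c; simp [wEps, wplane]⟩
  · exact ⟨_, good_zero, by funext a b c; simp [wEps]⟩
  · exact ⟨_, good_zero, by funext a b c; simp [wEps]⟩
  · exact ⟨_, good_zero, by funext a b c; simp [wEps]⟩
  · exact ⟨_, good_log, by funext a b c; simp [wEps]⟩

lemma scale_der (F : ℝ → ℝ) (d a x r ρ R l : ℝ) (hr : 0 < r) (hR : 0 < R) (hl : l ≠ 0)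
    (hρ : ρ = R / r) (h : HasDerivAt F d ((x - a) / r)) (hd : |d| ≤ 11 / ρ) :
    (deriv (fun t => (-1 / l) * F ((t - a) / r)) x) ^ 2 ≤ 121 / (R ^ 2 * l ^ 2) := by
  have h1 : HasDerivAt (fun t => (t - a) / r) (1 / r) x :=
    ((hasDerivAt_id x).sub_const a).div_const r
  have h2 := (h.comp x h1).const_mul (-1 / l)
  have h3 : deriv (fun t => (-1 / l) * F ((t - a) / r)) x = -1 / l * (d * (1 / r)) := h2.deriv
  rw [h3]
  have h4 : d ^ 2 ≤ (11 / ρ) ^ 2 := sq_le_sq' (by linarith [abs_le.1 hd]) (by linarith [abs_le.1 hd])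
  calc (-1 / l * (d * (1 / r))) ^ 2 = d ^ 2 * (1 / (l ^ 2 * r ^ 2)) := by field_simp
    _ ≤ (11 / ρ) ^ 2 * (1 / (l ^ 2 * r ^ 2)) := by gcongr
    _ = 121 / (R ^ 2 * l ^ 2) := by rw [hρ]; field_simp; norm_num

/-- There exist `C₀, C₁ > 0` independent of `ε`, `r` and `k` such that, for all
`r ≤ R^k(x) ≤ 1` and `0 < x₃ < L`: `|e_m − w_ε^{mk}(x)| ≤ C₀` and, for `i = 1,2,3`,
`|∂w_ε^{mk}/∂x_i(x)|² ≤ C₁/((R^k(x))² ln² r)`. -/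
theorem stmt11 (lam mu : ℝ) (hlam : 0 ≤ lam) (hmu : 0 < mu) (κ : ℝ)
    (hκ : κ = (lam + 3 * mu) / (lam + mu)) (L : ℝ) (hL : 0 < L) :
    ∃ C₀ > (0 : ℝ), ∃ C₁ > (0 : ℝ), ∀ ε : ℝ, 0 < ε → ∀ r ∈ Set.Ioo (0 : ℝ) (1 / 2),
      ∀ (k : ℤ × ℤ) (m : Fin 3) (x : ℝ × ℝ × ℝ),
        r ≤ Rk ε k x → Rk ε k x ≤ 1 → 0 < x.2.2 → x.2.2 < L →
        Real.sqrt (∑ i : Fin 3,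
            ((if i = m then 1 else 0) - wEps κ ε r k m i x.1 x.2.1 x.2.2) ^ 2) ≤ C₀ ∧
        ∀ i : Fin 3,
          ∑ j : Fin 3, (pd3 i (wEps κ ε r k m j) x.1 x.2.1 x.2.2) ^ 2 ≤
            C₁ / ((Rk ε k x) ^ 2 * (Real.log r) ^ 2) := by
  have hκ1 : 1 ≤ κ := by
    rw [hκ, le_div_iff₀ (by linarith)]; linarith
  refine ⟨11, by norm_num, 363, by norm_num, ?_⟩
  rintro ε hε r ⟨hr0, hr1⟩ k m x hx1 hx2 - -
  have hR : 0 < Rk ε k x := lt_of_lt_of_le hr0 hx1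
  have hl : Real.log r < -(1 / 2) := by
    have := Real.log_lt_log hr0 hr1
    rw [one_div, Real.log_inv] at this
    linarith [Real.log_two_gt_d9]
  have hl0 : Real.log r ≠ 0 := by linarith
  set ρ := Rk ε k x / r with hρd
  have hρ : 1 ≤ ρ := by rw [hρd, le_div_iff₀ hr0]; linarith
  have hρ2 : ρ ^ 2 = ((x.1 - ε * k.1) / r) ^ 2 + ((x.2.1 - ε * k.2) / r) ^ 2 := by
    rw [hρd, div_pow, Rk, Real.sq_sqrt (by positivity)]; ring
  have hlρ : Real.log ρ ≤ -Real.log r := by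
    rw [hρd, Real.log_div hR.ne' hr0.ne']
    linarith [Real.log_nonpos hR.le hx2]
  have hval : ∀ j, |wEps κ ε r k m j x.1 x.2.1 x.2.2| ≤ 5 := by
    intro j
    obtain ⟨f, hf, e⟩ := wEps_good κ ε r hκ1 k m j
    have h1 := (hf _ _ ρ hρ hρ2).1
    rw [e]
    simp only [abs_mul, abs_div, abs_neg, abs_one]
    rw [abs_of_neg (by linarith : Real.log r < 0), one_div_mul_eq_div, div_le_iff₀ (by linarith)]
    linarith
  constructor
  · rw [Real.sqrt_le_left (by norm_num)]
    have hb : ∀ j ∈ (Finset.univ : Finset (Fin 3)),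
        ((if j = m then (1:ℝ) else 0) - wEps κ ε r k m j x.1 x.2.1 x.2.2) ^ 2 ≤ 36 := by
      intro j _
      have := abs_le.1 (hval j)
      split_ifs <;> nlinarith
    have := Finset.sum_le_sum hb
    refine this.trans ?_
    simp; norm_num
  · intro i
    have hb : ∀ j ∈ (Finset.univ : Finset (Fin 3)),
        (pd3 i (wEps κ ε r k m j) x.1 x.2.1 x.2.2) ^ 2 ≤
          121 / ((Rk ε k x) ^ 2 * (Real.log r) ^ 2) := by
      intro j _
      obtain ⟨f, hf, e⟩ := wEps_good κ ε r hκ1 k m j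
      obtain ⟨-, ⟨d, h1, h2⟩, ⟨d', h3, h4⟩⟩ := hf _ _ ρ hρ hρ2
      rw [e]
      unfold pd3
      split_ifs
      · exact scale_der (fun t => f t _) d _ _ r ρ _ _ hr0 hR hl0 hρd h1 h2
      · exact scale_der (fun t => f _ t) d' _ _ r ρ _ _ hr0 hR hl0 hρd h3 h4
      · simp only [deriv_const]
        have : (0:ℝ) ≤ 121 / ((Rk ε k x) ^ 2 * (Real.log r) ^ 2) := by positivity
        simpa using this
    refine (Finset.sum_le_sum hb).trans (le_of_eq ?_)
    simp; ring
end

section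
/- Let v ∈ C²(closure(Ω), ℝ³), and let λ_ε ≥ 0 and μ_ε > 0 be arbitrary coefficients. For ε > 0, 0 < r_ε < s_ε ≤ ε/2 ≤ 1 and k ∈ K(ε), define on the cylinder B_ε^k = {x : R^k(x) < s_ε, 0 < x₃ < L} the field R_ε(v) by (R_ε(v))_α(x) = v_α(εk₁, εk₂, x₃) − (λ_ε/(2(μ_ε+λ_ε)))(x_α − εk_α)(∂v₃/∂x₃)(εk₁, εk₂, x₃) for α = 1,2, and (R_ε(v))₃(x) = v₃(εk₁, εk₂, x₃) − (x₁−εk₁)(∂v₁/∂x₃)(εk₁, εk₂, x₃) − (x₂−εk₂)(∂v₂/∂x₃)(εk₁, εk₂, x₃). Then there exists a constant C > 0, depending only on v (and not on ε, r_ε, s_ε, λ_ε, μ_ε, k), such that on B_ε^k the derivative of R_ε(v) satisfies |∇R_ε(v)(x)| ≤ C, on T_ε^k (i.e. where R^k(x) < r_ε) one has |R_ε(v)(x) − v(x)| ≤ C r_ε, and on B_ε^k one has |R_ε(v)(x) − v(x)| ≤ C s_ε. -/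
open Real MeasureTheory Filter

/-- Partial derivative in the third variable of the `j`-th component of a field
`v : ℝ³ → ℝ³`, evaluated at `(a,b,c)`. -/
noncomputable def d3 (v : ℝ × ℝ × ℝ → Fin 3 → ℝ) (j : Fin 3) (a b c : ℝ) : ℝ :=
  deriv (fun t => v (a, b, t) j) c

/-- The local approximation field `R_ε(v)` on the cylinder indexed by `k`:
`(R_ε(v))_α(x) = v_α(εk₁,εk₂,x₃) − (λ_ε/(2(μ_ε+λ_ε)))(x_α−εk_α)(∂v₃/∂x₃)(εk₁,εk₂,x₃)`
for `α = 1,2`, and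
`(R_ε(v))₃(x) = v₃(εk₁,εk₂,x₃) − (x₁−εk₁)(∂v₁/∂x₃)(εk₁,εk₂,x₃) − (x₂−εk₂)(∂v₂/∂x₃)(εk₁,εk₂,x₃)`. -/
noncomputable def Rop (lamε muε ε : ℝ) (k : ℤ × ℤ) (v : ℝ × ℝ × ℝ → Fin 3 → ℝ)
    (x : ℝ × ℝ × ℝ) : Fin 3 → ℝ := fun i =>
  if i = 0 then
    v (ε * k.1, ε * k.2, x.2.2) 0 -
      lamε / (2 * (muε + lamε)) * (x.1 - ε * k.1) * d3 v 2 (ε * k.1) (ε * k.2) x.2.2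
  else if i = 1 then
    v (ε * k.1, ε * k.2, x.2.2) 1 -
      lamε / (2 * (muε + lamε)) * (x.2.1 - ε * k.2) * d3 v 2 (ε * k.1) (ε * k.2) x.2.2
  else
    v (ε * k.1, ε * k.2, x.2.2) 2 -
      (x.1 - ε * k.1) * d3 v 0 (ε * k.1) (ε * k.2) x.2.2 -
      (x.2.1 - ε * k.2) * d3 v 1 (ε * k.1) (ε * k.2) x.2.2

lemma aux_bound (W : Set (ℝ × ℝ × ℝ)) (hW : IsOpen W) (hK : IsCompact (closure W))
    (v : ℝ × ℝ × ℝ → Fin 3 → ℝ) (hv : ContDiffOn ℝ 2 v (closure W)) :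
    ∃ M : ℝ, 0 < M ∧ ∀ y ∈ W, ‖fderiv ℝ v y‖ ≤ M ∧ ‖fderiv ℝ (fderiv ℝ v) y‖ ≤ M := by
  have key : ∃ M : ℝ, ∀ y ∈ closure W ∩ W,
      ‖fderiv ℝ v y‖ ≤ M ∧ ‖fderiv ℝ (fderiv ℝ v) y‖ ≤ M := by
    refine hK.induction_on (p := fun s => ∃ M : ℝ, ∀ y ∈ s ∩ W,
      ‖fderiv ℝ v y‖ ≤ M ∧ ‖fderiv ℝ (fderiv ℝ v) y‖ ≤ M) ⟨0, by simp⟩ ?_ ?_ ?_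
    · rintro s t hst ⟨M, hM⟩
      exact ⟨M, fun y hy => hM y ⟨hst hy.1, hy.2⟩⟩
    · rintro s t ⟨M, hM⟩ ⟨N, hN⟩
      refine ⟨max M N, ?_⟩
      rintro y ⟨hy | hy, hyW⟩
      · exact ⟨(hM y ⟨hy, hyW⟩).1.trans (le_max_left _ _), (hM y ⟨hy, hyW⟩).2.trans (le_max_left _ _)⟩
      · exact ⟨(hN y ⟨hy, hyW⟩).1.trans (le_max_right _ _), (hN y ⟨hy, hyW⟩).2.trans (le_max_right _ _)⟩
    · intro x hx
      obtain ⟨u, hu, p, hp⟩ := (hv x hx) 2 le_rfl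
      rw [Set.insert_eq_of_mem hx] at hu
      have hxu : x ∈ u := mem_of_mem_nhdsWithin hx hu
      have c1 := (hp.cont 1 (by norm_num)) x hxu
      have c2 := (hp.cont 2 (by norm_num)) x hxu
      have e1 : ∀ᶠ y in nhdsWithin x u, ‖p y 1‖ < ‖p x 1‖ + 1 :=
        c1.norm.eventually_lt_const (by linarith)
      have e2 : ∀ᶠ y in nhdsWithin x u, ‖p y 2‖ < ‖p x 2‖ + 1 :=
        c2.norm.eventually_lt_const (by linarith)
      have e3 : ∀ᶠ y in nhdsWithin x (closure W), y ∈ u ∧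
          ‖p y 1‖ < ‖p x 1‖ + 1 ∧ ‖p y 2‖ < ‖p x 2‖ + 1 := by
        have hle : nhdsWithin x (closure W) ≤ nhdsWithin x u := nhdsWithin_le_of_mem hu
        filter_upwards [hu, hle e1, hle e2] with y h1 h2 h3 using ⟨h1, h2, h3⟩
      obtain ⟨O, hO, hxO, hOs⟩ := mem_nhdsWithin.1 e3
      refine ⟨O ∩ closure W, Filter.inter_mem (mem_nhdsWithin_of_mem_nhds (hO.mem_nhds hxO)) self_mem_nhdsWithin, max (‖p x 1‖ + 1) (‖p x 2‖ + 1), ?_⟩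
      rintro y ⟨⟨hyO, hyc⟩, hyW⟩
      have hOW : IsOpen (O ∩ W) := hO.inter hW
      have hp' : HasFTaylorSeriesUpToOn 2 v p (O ∩ W) :=
        hp.mono fun z hz => (hOs ⟨hz.1, subset_closure hz.2⟩).1
      have q1 := hp'.eq_iteratedFDerivWithin_of_uniqueDiffOn (m := 1) (by norm_num)
        hOW.uniqueDiffOn ⟨hyO, hyW⟩
      have q2 := hp'.eq_iteratedFDerivWithin_of_uniqueDiffOn (m := 2) (by norm_num)
        hOW.uniqueDiffOn ⟨hyO, hyW⟩
      rw [iteratedFDerivWithin_of_isOpen _ hOW ⟨hyO, hyW⟩] at q1 q2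
      obtain ⟨_, b1, b2⟩ := hOs ⟨hyO, hyc⟩
      rw [q1, norm_iteratedFDeriv_one] at b1
      rw [q2, ← norm_iteratedFDeriv_fderiv, norm_iteratedFDeriv_one] at b2
      exact ⟨b1.le.trans (le_max_left _ _), b2.le.trans (le_max_right _ _)⟩
  obtain ⟨M, hM⟩ := key
  refine ⟨max M 1, by positivity, fun y hy => ?_⟩
  have := hM y ⟨subset_closure hy, hy⟩
  exact ⟨this.1.trans (le_max_left _ _), this.2.trans (le_max_left _ _)⟩

lemma omega_open (ω : Set (ℝ × ℝ)) (hω : IsOpen ω) (L : ℝ) : IsOpen (OmegaSet ω L) := by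
  have h1 : Continuous fun x : ℝ × ℝ × ℝ => (x.1, x.2.1) := by fun_prop
  have h2 : Continuous fun x : ℝ × ℝ × ℝ => x.2.2 := by fun_prop
  exact (hω.preimage h1).inter (isOpen_Ioo.preimage h2)

lemma omega_compact (ω : Set (ℝ × ℝ)) (hb : Bornology.IsBounded ω) (L : ℝ) :
    IsCompact (closure (OmegaSet ω L)) := by
  apply Bornology.IsBounded.isCompact_closure
  have h : Bornology.IsBounded ((fun q : (ℝ × ℝ) × ℝ => (q.1.1, q.1.2, q.2)) ''
      (closure ω ×ˢ Set.Icc 0 L)) :=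
    ((hb.isCompact_closure.prod isCompact_Icc).image (by fun_prop)).isBounded
  refine h.subset ?_
  rintro ⟨a, b, c⟩ ⟨h1, h2⟩
  exact ⟨((a, b), c), ⟨subset_closure h1, Set.Ioo_subset_Icc_self h2⟩, rfl⟩

lemma aux_all (ω : Set (ℝ × ℝ)) (hω : IsOpen ω) (hb : Bornology.IsBounded ω)
    (L : ℝ) (v : ℝ × ℝ × ℝ → Fin 3 → ℝ)
    (hv : ContDiffOn ℝ 2 v (closure (OmegaSet ω L))) :
    ∃ M : ℝ, 0 < M ∧
      (∀ S ⊆ OmegaSet ω L, Convex ℝ S → ∀ x ∈ S, ∀ y ∈ S, ‖v x - v y‖ ≤ M * ‖x - y‖) ∧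
      (∀ j a b t, (a, b, t) ∈ OmegaSet ω L → |d3 v j a b t| ≤ M) ∧
      (∀ j a b t s, (a, b) ∈ ω → t ∈ Set.Ioo 0 L → s ∈ Set.Ioo 0 L →
        |d3 v j a b t - d3 v j a b s| ≤ M * |t - s|) := by
  have hW := omega_open ω hω L
  obtain ⟨M, hM, hbd⟩ := aux_bound _ hW (omega_compact ω hb L) v hv
  have hv' : ContDiffOn ℝ 2 v (OmegaSet ω L) := hv.mono subset_closure
  have hd : ∀ x ∈ OmegaSet ω L, DifferentiableAt ℝ v x := fun x hx =>
    ((hv' x hx).contDiffAt (hW.mem_nhds hx)).differentiableAt (by norm_num)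
  have hd2 : ∀ x ∈ OmegaSet ω L, DifferentiableAt ℝ (fderiv ℝ v) x := fun x hx =>
    (((hv' x hx).contDiffAt (hW.mem_nhds hx)).fderiv_right (m := 1) (by norm_num)).differentiableAt
      (by norm_num)
  have hd3 : ∀ j a b t, (a, b, t) ∈ OmegaSet ω L →
      d3 v j a b t = fderiv ℝ v (a, b, t) (0, 0, 1) j := by
    intro j a b t h
    have h1 : HasDerivAt (fun t : ℝ => (a, b, t)) ((0 : ℝ), (0 : ℝ), (1 : ℝ)) t :=
      (hasDerivAt_const t a).prodMk ((hasDerivAt_const t b).prodMk (hasDerivAt_id t))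
    have h2 := (hd _ h).hasFDerivAt.comp_hasDerivAt t h1
    exact ((hasDerivAt_pi.1 h2) j).deriv
  have hn : ‖((0 : ℝ), (0 : ℝ), (1 : ℝ))‖ = 1 := by simp [Prod.norm_def]
  have hop : ∀ (A : ℝ × ℝ × ℝ →L[ℝ] (Fin 3 → ℝ)) j, |A (0, 0, 1) j| ≤ ‖A‖ := by
    intro A j
    have h1 := A.le_opNorm (0, 0, 1)
    rw [hn, mul_one] at h1
    exact (norm_le_pi_norm (A (0, 0, 1)) j).trans h1
  refine ⟨M, hM, ?_, ?_, ?_⟩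
  · intro S hS hc x hx y hy
    exact hc.norm_image_sub_le_of_norm_fderiv_le (fun z hz => hd z (hS hz))
      (fun z hz => (hbd z (hS hz)).1) hy hx
  · intro j a b t h
    rw [hd3 j a b t h]
    exact (hop _ _).trans (hbd _ h).1
  · intro j a b t s hab ht hs
    have hSc : Convex ℝ (({a} : Set ℝ) ×ˢ (({b} : Set ℝ) ×ˢ Set.Ioo 0 L)) :=
      (convex_singleton a).prod ((convex_singleton b).prod (convex_Ioo 0 L))
    have hS : (({a} : Set ℝ) ×ˢ (({b} : Set ℝ) ×ˢ Set.Ioo 0 L)) ⊆ OmegaSet ω L := by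
      rintro ⟨x, y, z⟩ ⟨rfl, rfl, hz⟩
      exact ⟨hab, hz⟩
    rw [hd3 j a b t ⟨hab, ht⟩, hd3 j a b s ⟨hab, hs⟩]
    have h := hSc.norm_image_sub_le_of_norm_fderiv_le (𝕜 := ℝ) (f := fderiv ℝ v)
      (fun z hz => hd2 z (hS hz))
      (fun z hz => (hbd z (hS hz)).2) (x := (a, b, s)) (y := (a, b, t)) ⟨rfl, rfl, hs⟩ ⟨rfl, rfl, ht⟩
    have h2 := hop (fderiv ℝ v (a, b, t) - fderiv ℝ v (a, b, s)) j
    have h3 : ‖((a, b, t) : ℝ × ℝ × ℝ) - (a, b, s)‖ = |t - s| := by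
      simp [Prod.norm_def]
    rw [h3] at h
    exact h2.trans h

lemma aux_mul (c p q d e M D : ℝ) (hc : |c| ≤ 1) (hp : |p| ≤ 2) (hd : |d - e| ≤ M * D)
    (hpq : |p - q| ≤ D) (he : |e| ≤ M) (hM : 0 < M) (hD : 0 ≤ D) :
    |c * p * d - c * q * e| ≤ 3 * M * D := by
  have : c * p * d - c * q * e = c * (p * (d - e) + (p - q) * e) := by ring
  rw [this, abs_mul]
  have h1 : |p * (d - e)| ≤ 2 * (M * D) := by
    rw [abs_mul]; exact mul_le_mul hp hd (abs_nonneg _) (by norm_num)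
  have h2 : |(p - q) * e| ≤ D * M := by
    rw [abs_mul]; exact mul_le_mul hpq he (abs_nonneg _) hD
  have h3 := abs_add_le (p * (d - e)) ((p - q) * e)
  have h4 : |p * (d - e) + (p - q) * e| ≤ 3 * M * D := by nlinarith
  calc _ ≤ 1 * (3 * M * D) := mul_le_mul hc h4 (abs_nonneg _) (by norm_num)
    _ = _ := one_mul _

lemma aux_small (c p d M r : ℝ) (hc : |c| ≤ 1) (hp : |p| ≤ r) (hd : |d| ≤ M) (hM : 0 < M) :
    |c * p * d| ≤ M * r := by
  have hr : 0 ≤ r := (abs_nonneg _).trans hp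
  rw [abs_mul, abs_mul]
  calc |c| * |p| * |d| ≤ 1 * r * M := by gcongr
    _ = _ := by ring

/-- For `v ∈ C²(closure Ω, ℝ³)` there is `C > 0`, depending only on `v`, such that for all
`ε`, `0 < r_ε < s_ε ≤ ε/2 ≤ 1`, all coefficients `λ_ε ≥ 0`, `μ_ε > 0` and all `k ∈ K(ε)`:
`|∇R_ε(v)| ≤ C` on `B_ε^k`, `|R_ε(v) − v| ≤ C r_ε` on `T_ε^k`, and
`|R_ε(v) − v| ≤ C s_ε` on `B_ε^k`. -/
theorem stmt16 (ω : Set (ℝ × ℝ)) (hω : IsOpen ω) (hb : Bornology.IsBounded ω)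
    (L : ℝ) (hL : 0 < L) (v : ℝ × ℝ × ℝ → Fin 3 → ℝ)
    (hv : ContDiffOn ℝ 2 v (closure (OmegaSet ω L))) :
    ∃ C > (0 : ℝ), ∀ ε rε sε lamε muε : ℝ,
      0 < ε → 0 < rε → rε < sε → sε ≤ ε / 2 → ε / 2 ≤ 1 → 0 ≤ lamε → 0 < muε →
      ∀ k ∈ Kset ω ε,
        (∀ x : ℝ × ℝ × ℝ, Rk ε k x < sε → x.2.2 ∈ Set.Ioo 0 L →
          ‖fderiv ℝ (Rop lamε muε ε k v) x‖ ≤ C) ∧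
        (∀ x : ℝ × ℝ × ℝ, Rk ε k x < rε → x.2.2 ∈ Set.Ioo 0 L →
          ‖Rop lamε muε ε k v x - v x‖ ≤ C * rε) ∧
        (∀ x : ℝ × ℝ × ℝ, Rk ε k x < sε → x.2.2 ∈ Set.Ioo 0 L →
          ‖Rop lamε muε ε k v x - v x‖ ≤ C * sε) := by
  obtain ⟨M, hM, hlip, hbd, hlip3⟩ := aux_all ω hω hb L v hv
  refine ⟨7 * M, by positivity, ?_⟩
  intro ε r s lam mu hε hr hrs hs hε1 hlam hmu k hk
  have hc : |lam / (2 * (mu + lam))| ≤ 1 := by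
    rw [abs_of_nonneg (by positivity), div_le_one (by positivity)]
    linarith
  have h1c : |(1 : ℝ)| ≤ 1 := by simp
  have hRk : ∀ x : ℝ × ℝ × ℝ, |x.1 - ε * k.1| ≤ Rk ε k x ∧ |x.2.1 - ε * k.2| ≤ Rk ε k x := by
    intro x
    exact ⟨Real.abs_le_sqrt (by nlinarith [sq_nonneg (x.2.1 - ε * k.2)]),
      Real.abs_le_sqrt (by nlinarith [sq_nonneg (x.1 - ε * k.1)])⟩
  have hSc : Convex ℝ (Set.Icc (ε * k.1 - ε / 2) (ε * k.1 + ε / 2) ×ˢ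
      (Set.Icc (ε * k.2 - ε / 2) (ε * k.2 + ε / 2) ×ˢ Set.Ioo 0 L)) :=
    (convex_Icc _ _).prod ((convex_Icc _ _).prod (convex_Ioo _ _))
  have hS : (Set.Icc (ε * k.1 - ε / 2) (ε * k.1 + ε / 2) ×ˢ
      (Set.Icc (ε * k.2 - ε / 2) (ε * k.2 + ε / 2) ×ˢ Set.Ioo 0 L)) ⊆ OmegaSet ω L := by
    rintro ⟨a, b, c⟩ ⟨h1, h2, h3⟩
    exact ⟨hk ⟨h1, h2⟩, h3⟩
  have hL' := hlip _ hS hSc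
  have hm1 : ε * k.1 ∈ Set.Icc (ε * k.1 - ε / 2) (ε * k.1 + ε / 2) :=
    ⟨by linarith, by linarith⟩
  have hm2 : ε * k.2 ∈ Set.Icc (ε * k.2 - ε / 2) (ε * k.2 + ε / 2) :=
    ⟨by linarith, by linarith⟩
  have hkω : (ε * k.1, ε * k.2) ∈ ω := hk ⟨hm1, hm2⟩
  have hclose : ∀ ρ : ℝ, ρ ≤ ε / 2 → ∀ x : ℝ × ℝ × ℝ, Rk ε k x < ρ → x.2.2 ∈ Set.Ioo 0 L →
      ‖Rop lam mu ε k v x - v x‖ ≤ 7 * M * ρ := by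
    intro ρ hρ x hx hx3
    obtain ⟨ha, hb'⟩ := hRk x
    have ha : |x.1 - ε * k.1| ≤ ρ := ha.trans hx.le
    have hb' : |x.2.1 - ε * k.2| ≤ ρ := hb'.trans hx.le
    have hρ0 : 0 ≤ ρ := (abs_nonneg _).trans ha
    have hxm : x ∈ (Set.Icc (ε * k.1 - ε / 2) (ε * k.1 + ε / 2) ×ˢ
      (Set.Icc (ε * k.2 - ε / 2) (ε * k.2 + ε / 2) ×ˢ Set.Ioo 0 L)) := by
      have := abs_le.1 ha
      have := abs_le.1 hb'
      exact ⟨⟨by linarith, by linarith⟩, ⟨by linarith, by linarith⟩, hx3⟩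
    have h := hL' (ε * k.1, ε * k.2, x.2.2) ⟨hm1, hm2, hx3⟩ x hxm
    have hnn : ‖((ε * k.1, ε * k.2, x.2.2) : ℝ × ℝ × ℝ) - x‖ ≤ ρ := by
      rw [norm_sub_rev]
      simp only [Prod.norm_def, Prod.fst_sub, Prod.snd_sub, Real.norm_eq_abs, sub_self, abs_zero]
      exact max_le ha (max_le hb' hρ0)
    have h' : ∀ j, |v (ε * k.1, ε * k.2, x.2.2) j - v x j| ≤ M * ρ := fun j =>
      (norm_le_pi_norm (v (ε * k.1, ε * k.2, x.2.2) - v x) j).trans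
        (h.trans (mul_le_mul_of_nonneg_left hnn hM.le))
    have hB : ∀ j, |d3 v j (ε * k.1) (ε * k.2) x.2.2| ≤ M := fun j => hbd j _ _ _ ⟨hkω, hx3⟩
    have hMρ : 0 ≤ M * ρ := by positivity
    rw [pi_norm_le_iff_of_nonneg (by positivity)]
    intro i
    have t1 := abs_le.1 (aux_small _ _ _ M ρ hc ha (hB 2) hM)
    have t2 := abs_le.1 (aux_small _ _ _ M ρ hc hb' (hB 2) hM)
    have t3 := abs_le.1 (aux_small _ _ _ M ρ h1c ha (hB 0) hM)
    have t4 := abs_le.1 (aux_small _ _ _ M ρ h1c hb' (hB 1) hM)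
    rw [one_mul] at t3 t4
    have u0 := abs_le.1 (h' 0)
    have u1 := abs_le.1 (h' 1)
    have u2 := abs_le.1 (h' 2)
    fin_cases i <;> simp [Rop] <;> rw [abs_le] <;> constructor <;> linarith
  refine ⟨?_, hclose r (by linarith), hclose s hs⟩
  intro x hx hx3
  refine norm_fderiv_le_of_lip' ℝ (by positivity) ?_
  have n1 : ∀ᶠ y : ℝ × ℝ × ℝ in nhds x, Rk ε k y < s := by
    have : Continuous (Rk ε k) := by unfold Rk; fun_prop
    exact this.continuousAt.eventually_lt_const hx
  have n2 : ∀ᶠ y : ℝ × ℝ × ℝ in nhds x, y.2.2 ∈ Set.Ioo 0 L := by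
    have : Continuous fun y : ℝ × ℝ × ℝ => y.2.2 := by fun_prop
    exact this.continuousAt.eventually_mem (isOpen_Ioo.mem_nhds hx3)
  filter_upwards [n1, n2] with y hy hy3
  have hD : 0 ≤ ‖y - x‖ := norm_nonneg _
  have d1 : |y.1 - x.1| ≤ ‖y - x‖ := norm_fst_le (y - x)
  have d2 : |y.2.1 - x.2.1| ≤ ‖y - x‖ := (norm_fst_le (y - x).2).trans (norm_snd_le (y - x))
  have d3' : |y.2.2 - x.2.2| ≤ ‖y - x‖ := (norm_snd_le (y - x).2).trans (norm_snd_le (y - x))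
  generalize ‖y - x‖ = D at *
  obtain ⟨ha, hb'⟩ := hRk y
  have ha : |y.1 - ε * k.1| ≤ 2 := by linarith
  have hb' : |y.2.1 - ε * k.2| ≤ 2 := by linarith
  have e1 : |(y.1 - ε * k.1) - (x.1 - ε * k.1)| ≤ D := by
    rwa [sub_sub_sub_cancel_right]
  have e2 : |(y.2.1 - ε * k.2) - (x.2.1 - ε * k.2)| ≤ D := by
    rwa [sub_sub_sub_cancel_right]
  have h := hL' (ε * k.1, ε * k.2, y.2.2) ⟨hm1, hm2, hy3⟩ (ε * k.1, ε * k.2, x.2.2) ⟨hm1, hm2, hx3⟩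
  have hnn : ‖((ε * k.1, ε * k.2, y.2.2) : ℝ × ℝ × ℝ) - (ε * k.1, ε * k.2, x.2.2)‖ ≤ D := by
    simpa [Prod.norm_def] using d3'
  have h' : ∀ j, |v (ε * k.1, ε * k.2, y.2.2) j - v (ε * k.1, ε * k.2, x.2.2) j| ≤ M * D := fun j =>
    (norm_le_pi_norm (v (ε * k.1, ε * k.2, y.2.2) - v (ε * k.1, ε * k.2, x.2.2)) j).trans
      (h.trans (mul_le_mul_of_nonneg_left hnn hM.le))
  have hB : ∀ j, |d3 v j (ε * k.1) (ε * k.2) x.2.2| ≤ M := fun j => hbd j _ _ _ ⟨hkω, hx3⟩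
  have hE : ∀ j, |d3 v j (ε * k.1) (ε * k.2) y.2.2 - d3 v j (ε * k.1) (ε * k.2) x.2.2| ≤ M * D :=
    fun j => (hlip3 j _ _ _ _ hkω hy3 hx3).trans (mul_le_mul_of_nonneg_left d3' hM.le)
  have hMρ : 0 ≤ M * D := by positivity
  rw [pi_norm_le_iff_of_nonneg (by positivity)]
  intro i
  have t1 := abs_le.1 (aux_mul _ _ _ _ _ M D hc ha (hE 2) e1 (hB 2) hM hD)
  have t2 := abs_le.1 (aux_mul _ _ _ _ _ M D hc hb' (hE 2) e2 (hB 2) hM hD)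
  have t3 := abs_le.1 (aux_mul _ _ _ _ _ M D h1c ha (hE 0) e1 (hB 0) hM hD)
  have t4 := abs_le.1 (aux_mul _ _ _ _ _ M D h1c hb' (hE 1) e2 (hB 1) hM hD)
  simp only [one_mul] at t3 t4
  have u0 := abs_le.1 (h' 0)
  have u1 := abs_le.1 (h' 1)
  have u2 := abs_le.1 (h' 2)
  fin_cases i <;> simp [Rop] <;> rw [abs_le] <;> constructor <;> linarith
end
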